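/- Let X be a real normed space and let f₁, f₂ : X → ℝ ∪ {−∞, +∞} be LĈ-subdifferentiable at a point x̄ ∈ dom f₁ ∩ dom f₂. If f₁(x) ≤ f₂(x) for all x ∈ X and f₁(x̄) = f₂(x̄), then for every l₁ ∈ D_{LĈθ}f₁(x̄) there exists l₂ ∈ ∂_{LĈθ}f₂(x̄) such that l₁(x) ≤ l₂(x) for all x ∈ X. -/

import Mathlib

/-- A concave function on the whole space that dominates a `k`-Lipschitz function is itself
`k`-Lipschitz. -/
theorem ConcaveOn.abs_sub_le_of_le {X : Type*} [NormedAddCommGroup X] [NormedSpace ℝ X]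
    {l m : X → ℝ} (hm : ConcaveOn ℝ Set.univ m) {k : ℝ}
    (hl : ∀ x y : X, |l x - l y| ≤ k * ‖x - y‖) (hlm : l ≤ m) (x y : X) :
    |m x - m y| ≤ k * ‖x - y‖ := by
  have key : ∀ u v : X, m u - m v ≤ k * ‖u - v‖ := by
    intro u v
    by_contra! hlt
    set d := m u - m v - k * ‖u - v‖ with hd
    have hdpos : 0 < d := sub_pos.2 hlt
    obtain ⟨n, hn⟩ := exists_nat_gt ((m u - l u) / d)
    rw [div_lt_iff₀ hdpos] at hn
    have ht : (0 : ℝ) < (n : ℝ) + 1 := by positivity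
    set t : ℝ := (n : ℝ) + 1 with ht_def
    set z : X := u + t • (v - u) with hz
    have hcomb : (1 - 1 / t) • u + (1 / t) • z = v := by
      rw [hz, smul_add, smul_smul, one_div_mul_cancel ht.ne']
      module
    have ht1 : 1 / t ≤ 1 := by
      rw [div_le_one ht, ht_def]
      linarith [n.cast_nonneg (α := ℝ)]
    have hconc := hm.2 (Set.mem_univ u) (Set.mem_univ z) (sub_nonneg.2 ht1)
      (by positivity) (sub_add_cancel 1 (1 / t))
    rw [hcomb, smul_eq_mul, smul_eq_mul] at hconc
    have hscaled : t * m v ≥ (t - 1) * m u + m z := by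
      have := mul_le_mul_of_nonneg_left hconc ht.le
      have heq : t * ((1 - 1 / t) * m u + 1 / t * m z) = (t - 1) * m u + m z := by
        field_simp
      linarith
    have hlz := (le_abs_self _).trans (hl u z)
    have hnorm : ‖u - z‖ = t * ‖u - v‖ := by
      rw [hz, show u - (u + t • (v - u)) = t • (u - v) by module, norm_smul,
        Real.norm_of_nonneg ht.le]
    rw [hnorm] at hlz
    have hmz := hlm z
    nlinarith
  exact abs_sub_le_iff.2 ⟨key x y, norm_sub_rev x y ▸ key y x⟩

/-- The pointwise supremum of a nonempty chain of pointwise bounded concave functions is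
concave. -/
theorem IsChain.concaveOn_iSup {X : Type*} [AddCommGroup X] [Module ℝ X]
    {c : Set (X → ℝ)} (hc : IsChain (· ≤ ·) c) (hne : c.Nonempty)
    (hbdd : ∀ x, BddAbove (Set.range fun m : c => m.1 x))
    (hconc : ∀ m ∈ c, ConcaveOn ℝ Set.univ m) :
    ConcaveOn ℝ Set.univ fun x => ⨆ m : c, m.1 x := by
  have : Nonempty c := hne.to_subtype
  refine ⟨convex_univ, fun x _ y _ a b ha hb hab => le_of_forall_pos_le_add fun ε hε => ?_⟩
  obtain ⟨p, hp⟩ := exists_lt_of_lt_ciSup (sub_lt_self (⨆ m : c, m.1 x) hε)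
  obtain ⟨q, hq⟩ := exists_lt_of_lt_ciSup (sub_lt_self (⨆ m : c, m.1 y) hε)
  obtain ⟨r, hpr, hqr⟩ : ∃ r : c, p.1 ≤ r.1 ∧ q.1 ≤ r.1 := by
    rcases hc.total p.2 q.2 with h | h
    · exact ⟨q, h, le_rfl⟩
    · exact ⟨p, le_rfl, h⟩
  have hr := (hconc r.1 r.2).2 (Set.mem_univ x) (Set.mem_univ y) ha hb hab
  have hle := le_ciSup (hbdd (a • x + b • y)) r
  have hx := mul_le_mul_of_nonneg_left (hp.le.trans (hpr x)) ha
  have hy := mul_le_mul_of_nonneg_left (hq.le.trans (hqr y)) hb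
  simp only [smul_eq_mul] at hr ⊢
  have hweights : a * ε + b * ε = ε := by rw [← add_mul, hab, one_mul]
  linarith

/-- If every member of a nonempty real family satisfies `u i + r ≤ e` in `EReal`, then so does
its supremum. -/
theorem EReal.coe_ciSup_add_coe_le {ι : Type*} [Nonempty ι] {u : ι → ℝ} {r : ℝ} {e : EReal}
    (h : ∀ i, (u i : EReal) + r ≤ e) : ((⨆ i, u i : ℝ) : EReal) + r ≤ e := by
  induction e with
  | bot => exact absurd (le_bot_iff.1 (h (Classical.arbitrary ι))) (EReal.coe_ne_bot (_ + r))
  | top => exact le_top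
  | coe e =>
    have hbound : ∀ i, u i ≤ e - r := fun i => _root_.le_sub_iff_add_le.2 (by exact_mod_cast h i)
    exact_mod_cast _root_.le_sub_iff_add_le.1 (ciSup_le hbound)

/-- If `f₁, f₂ : X → ℝ ∪ {−∞, +∞}` are `LĈ`-subdifferentiable at
`x₀ ∈ dom f₁ ∩ dom f₂`, `f₁ ≤ f₂` pointwise and `f₁(x₀) = f₂(x₀)`, then every
`l₁ ∈ D_{LĈθ}f₁(x₀)` is dominated pointwise by some `l₂ ∈ ∂_{LĈθ}f₂(x₀)`. -/
theorem statement17 {X : Type*} [NormedAddCommGroup X] [NormedSpace ℝ X]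
    (f₁ f₂ : X → EReal) (x₀ : X)
    (h₁dom : f₁ x₀ ≠ ⊤ ∧ f₁ x₀ ≠ ⊥) (h₂dom : f₂ x₀ ≠ ⊤ ∧ f₂ x₀ ≠ ⊥)
    (LC : Set (X → ℝ))
    (hLC : LC = {h : X → ℝ | ConcaveOn ℝ Set.univ h ∧
        ∃ k : ℝ, 0 ≤ k ∧ ∀ x y : X, |h x - h y| ≤ k * ‖x - y‖})
    (hsub₁ : ∃ h ∈ LC, (∀ x, (h x : EReal) ≤ f₁ x) ∧ (h x₀ : EReal) = f₁ x₀)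
    (hsub₂ : ∃ h ∈ LC, (∀ x, (h x : EReal) ≤ f₂ x) ∧ (h x₀ : EReal) = f₂ x₀)
    (hle : ∀ x, f₁ x ≤ f₂ x) (heq : f₁ x₀ = f₂ x₀)
    (D : (X → EReal) → Set (X → ℝ))
    (hD : ∀ g : X → EReal, D g = {l : X → ℝ | l ∈ LC ∧ l 0 = 0 ∧
        ∀ x, (l (x - x₀) : EReal) + g x₀ ≤ g x})
    (P : (X → EReal) → Set (X → ℝ))
    (hP : ∀ g : X → EReal, P g = {l ∈ D g | ∀ m ∈ D g, l ≤ m → m = l}) :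
    ∀ l₁ ∈ D f₁, ∃ l₂ ∈ P f₂, ∀ x, l₁ x ≤ l₂ x := by
  subst hLC
  intro l₁ hl₁
  rw [hD] at hl₁
  obtain ⟨⟨hl₁conc, k, hk, hl₁lip⟩, hl₁zero, hl₁sub⟩ := hl₁
  have hl₁D : l₁ ∈ D f₂ := by
    rw [hD]
    exact ⟨⟨hl₁conc, k, hk, hl₁lip⟩, hl₁zero, fun x => heq ▸ (hl₁sub x).trans (hle x)⟩
  obtain ⟨r, hr⟩ : ∃ r : ℝ, (r : EReal) = f₂ x₀ :=
    ⟨(f₂ x₀).toReal, EReal.coe_toReal h₂dom.1 h₂dom.2⟩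
  obtain ⟨l₂, hl₁₂, hmax⟩ := zorn_le_nonempty₀ {m | m ∈ D f₂ ∧ l₁ ≤ m} (by
    intro c hcs hc y hy
    have : Nonempty c := ⟨⟨y, hy⟩⟩
    have hmem : ∀ m ∈ c, _ := fun m hm => (hD f₂ ▸ (hcs hm).1 :)
    have hlip : ∀ m ∈ c, ∀ x y, |m x - m y| ≤ k * ‖x - y‖ := fun m hm =>
      (hmem m hm).1.1.abs_sub_le_of_le hl₁lip (hcs hm).2
    have hbdd : ∀ x, BddAbove (Set.range fun m : c => m.1 x) := by
      refine fun x => ⟨k * ‖x‖, ?_⟩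
      rintro _ ⟨m, rfl⟩
      simpa [(hmem m.1 m.2).2.1] using (le_abs_self _).trans (hlip m.1 m.2 x 0)
    have hub : ∀ m ∈ c, m ≤ fun x => ⨆ m : c, m.1 x := fun m hm x =>
      le_ciSup (hbdd x) ⟨m, hm⟩
    have hle_sup := (hcs hy).2.trans (hub y hy)
    have hconc := hc.concaveOn_iSup ⟨y, hy⟩ hbdd fun m hm => (hmem m hm).1.1
    refine ⟨fun x => ⨆ m : c, m.1 x, ⟨?_, hle_sup⟩, hub⟩
    rw [hD]
    refine ⟨⟨hconc, k, hk, hconc.abs_sub_le_of_le hl₁lip hle_sup⟩, ?_, fun x => ?_⟩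
    · simp [fun m : c => (hmem m.1 m.2).2.1]
    · rw [← hr]
      exact EReal.coe_ciSup_add_coe_le fun m => hr ▸ (hmem m.1 m.2).2.2 x)
    l₁ ⟨hl₁D, le_rfl⟩
  refine ⟨l₂, ?_, hl₁₂⟩
  rw [hP]
  exact ⟨hmax.prop.1, fun m hm hlm => (hmax.eq_of_le ⟨hm, hl₁₂.trans hlm⟩ hlm).symm⟩
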